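/- arXiv:1507.00745 — 9 statements merged into one kernel-verified Lean document; each statement's English description precedes it below -/
import Mathlib

section
/- Let p and l be distinct primes, q a power of p, and n a positive integer coprime to l. Let E ⊆ L be an extension of finite fields with |E| = q^n and [L : E] = l (so |L| = q^{l·n}). For every group homomorphism φ : Lˣ → ℂˣ the following are equivalent: (i) there exists an integer i ≥ 1 such that φ(x)^q = φ(x)^(q^(l·i)) for all x ∈ Lˣ; (ii) there exists a group homomorphism ψ : Eˣ → ℂˣ such that φ(x) = ψ(N_{L/E}(x)) for all x ∈ Lˣ. -/
/-- In a cyclic group of order `a * b`, every element killed by `b` is an `a`-th power. -/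
theorem IsCyclic.exists_pow_eq_of_pow_eq_one {G : Type*} [Group G] [IsCyclic G] {a b : ℕ}
    (hb : 0 < b) (hG : Nat.card G = a * b) {x : G} (hx : x ^ b = 1) : ∃ y : G, y ^ a = x := by
  obtain ⟨g, hg⟩ := IsCyclic.exists_generator (α := G)
  obtain ⟨k, rfl⟩ := Subgroup.mem_zpowers_iff.mp (hg x)
  have hdvd : (a : ℤ) * b ∣ k * b := by
    rw [← zpow_natCast, ← zpow_mul, ← orderOf_dvd_iff_zpow_eq_one,
      orderOf_eq_card_of_forall_mem_zpowers hg, hG] at hx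
    exact_mod_cast hx
  obtain ⟨c, rfl⟩ := Int.dvd_of_mul_dvd_mul_right (by exact_mod_cast hb.ne') hdvd
  exact ⟨g ^ c, by rw [← zpow_natCast, ← zpow_mul, mul_comm]⟩

/-- Hilbert 90 for finite fields: units of norm one are `(|E| - 1)`-th powers. -/
theorem FiniteField.exists_pow_card_sub_one_eq_of_norm_eq_one {E L : Type*} [Field E] [Field L]
    [Algebra E L] [Fintype E] [Fintype L] {x : Lˣ}
    (hx : Units.map (Algebra.norm E : L →* E) x = 1) :
    ∃ y : Lˣ, y ^ (Fintype.card E - 1) = x := by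
  have hdvd : Fintype.card E - 1 ∣ Fintype.card L - 1 := by
    rw [Module.card_eq_pow_finrank (K := E) (V := L)]
    simpa using Nat.sub_dvd_pow_sub_pow (Fintype.card E) 1 (Module.finrank E L)
  have hE : 0 < Fintype.card E - 1 := Nat.sub_pos_of_lt Fintype.one_lt_card
  have hL : 0 < Fintype.card L - 1 := Nat.sub_pos_of_lt Fintype.one_lt_card
  refine IsCyclic.exists_pow_eq_of_pow_eq_one
    (b := (Fintype.card L - 1) / (Fintype.card E - 1))
    (Nat.div_pos (Nat.le_of_dvd hL hdvd) hE) ?_ ?_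
  · rw [Nat.mul_div_cancel' hdvd, Nat.card_units, Nat.card_eq_fintype_card]
  · have h : algebraMap E L (Algebra.norm E (x : L)) = 1 := by
      have := congrArg Units.val hx
      simp only [Units.coe_map, Units.val_one] at this
      rw [this, map_one]
    rw [FiniteField.algebraMap_norm_eq_pow, Nat.card_eq_fintype_card,
      Nat.card_eq_fintype_card] at h
    exact Units.ext (by simpa using h)

/-- A character of `Lˣ` fixed by the `|E|`-power map factors through the norm. -/
theorem FiniteField.exists_eq_comp_norm_of_pow_card_eq {E L M : Type*} [Field E] [Field L]
    [Algebra E L] [Fintype E] [Fintype L] [Group M] {φ : Lˣ →* M}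
    (hφ : ∀ x, φ x ^ Fintype.card E = φ x) :
    ∃ ψ : Eˣ →* M, ∀ x, φ x = ψ (Units.map (Algebra.norm E : L →* E) x) := by
  have hker : (Units.map (Algebra.norm E : L →* E)).ker ≤ φ.ker := fun x hx ↦ by
    obtain ⟨y, rfl⟩ :=
      FiniteField.exists_pow_card_sub_one_eq_of_norm_eq_one (MonoidHom.mem_ker.mp hx)
    rw [MonoidHom.mem_ker, map_pow, ← mul_eq_right (b := φ y), ← pow_succ,
      Nat.sub_add_cancel Fintype.card_pos, hφ]
  have hs : Function.Surjective (Units.map (Algebra.norm E : L →* E)) :=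
    FiniteField.unitsMap_norm_surjective E L
  exact ⟨MonoidHom.liftOfSurjective _ hs ⟨φ, hker⟩, fun x ↦
    (MonoidHom.liftOfRightInverse_comp_apply _ _ _ ⟨φ, hker⟩ x).symm⟩

theorem Function.isPeriodicPt_pow_iff {M : Type*} [Monoid M] {q n : ℕ} {y : M} :
    IsPeriodicPt (fun z : M ↦ z ^ q) n y ↔ y ^ q ^ n = y := by
  rw [IsPeriodicPt, IsFixedPt, pow_iterate]

/-- If `f y = f^[l * i] y` and `y` has period `l * n` under `f`, then `y` has period `n`. -/
theorem Function.IsPeriodicPt.of_apply_eq_iterate_mul {α : Type*} {f : α → α} {y : α}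
    {l n i : ℕ} (hl : 0 < l) (hn : 0 < n) (hi : 0 < i) (hper : IsPeriodicPt f (l * n) y)
    (h : f y = f^[l * i] y) : IsPeriodicPt f n y := by
  have hln := Nat.mul_pos hl hn
  have hli := Nat.mul_pos hl hi
  have hper' : IsPeriodicPt f (l * i - 1) y := by
    have h' := congrArg f^[l * n - 1] h
    rw [← Function.iterate_succ_apply, ← Function.iterate_add_apply,
      show (l * n - 1).succ = l * n by omega,
      show l * n - 1 + l * i = l * i - 1 + l * n by omega, Function.iterate_add_apply,
      hper.eq] at h'
    exact h'.symm
  have hcop : Nat.Coprime (l * i - 1) l := by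
    have hsub : l * i - 1 + 1 = l * i := by omega
    refine Nat.Coprime.coprime_dvd_right (dvd_mul_right l i) ?_
    rw [← hsub]
    simp
  refine (hper'.gcd hper).trans_dvd ?_
  exact (Nat.Coprime.coprime_dvd_left (Nat.gcd_dvd_left _ _) hcop).dvd_of_dvd_mul_left
    (Nat.gcd_dvd_right _ _)


/-- Let `p` and `l` be distinct primes, `q` a power of `p`, and `n` a
positive integer coprime to `l`.  Let `E ⊆ L` be an extension of finite fields with
`|E| = q ^ n` and `[L : E] = l`.  For every group homomorphism `φ : Lˣ → ℂˣ` the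
following are equivalent:
(i)  there is an integer `i ≥ 1` such that `φ(x) ^ q = φ(x) ^ (q ^ (l * i))` for all `x`;
(ii) there is a group homomorphism `ψ : Eˣ → ℂˣ` with `φ(x) = ψ (N_{L/E} x)` for all `x`. -/
theorem frobenius_fixed_iff_factors_through_norm
    (p l : ℕ) (hp : p.Prime) (hl : l.Prime) (hpl : p ≠ l)
    (q n : ℕ) (hq : ∃ a : ℕ, 0 < a ∧ q = p ^ a) (hn : 0 < n) (hln : Nat.Coprime l n)
    (E L : Type) [Field E] [Field L] [Algebra E L] [Fintype E] [Fintype L]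
    (hE : Fintype.card E = q ^ n) (hdeg : Module.finrank E L = l)
    (φ : Lˣ →* ℂˣ) :
    (∃ i : ℕ, 1 ≤ i ∧ ∀ x : Lˣ, φ x ^ q = φ x ^ q ^ (l * i)) ↔
      (∃ ψ : Eˣ →* ℂˣ, ∀ x : Lˣ,
        φ x = ψ (Units.map (Algebra.norm E : L →* E) x)) := by
  have hcardL : Fintype.card L = q ^ (l * n) := by
    rw [Module.card_eq_pow_finrank (K := E) (V := L), hE, hdeg, ← pow_mul, mul_comm]
  constructor
  · rintro ⟨i, hi, h⟩
    refine FiniteField.exists_eq_comp_norm_of_pow_card_eq fun x ↦ ?_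
    have hper : Function.IsPeriodicPt (fun y : ℂˣ ↦ y ^ q) (l * n) (φ x) := by
      have hx : x ^ q ^ (l * n) = x :=
        Units.ext (by simpa [hcardL] using FiniteField.pow_card (x : L))
      rw [Function.isPeriodicPt_pow_iff, ← map_pow, hx]
    have hfix := hper.of_apply_eq_iterate_mul hl.pos hn hi (by simpa [pow_iterate] using h x)
    rwa [hE, ← Function.isPeriodicPt_pow_iff]
  · rintro ⟨ψ, hψ⟩
    obtain ⟨i, hi, k, hk⟩ : ∃ i, 1 ≤ i ∧ ∃ k, l * i = n * k + 1 := by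
      obtain rfl | hn1 := Nat.eq_or_lt_of_le (Nat.succ_le_of_lt hn)
      · exact ⟨1, le_rfl, l - 1, by have := hl.pos; omega⟩
      · obtain ⟨i, -, hi⟩ := Nat.exists_mul_mod_eq_one_of_coprime hln hn1
        refine ⟨i, Nat.pos_of_ne_zero ?_, l * i / n, by rw [← hi, Nat.div_add_mod]⟩
        rintro rfl
        simp at hi
    refine ⟨i, hi, fun x ↦ ?_⟩
    have hper : Function.IsPeriodicPt (fun y : ℂˣ ↦ y ^ q) n (φ x) := by
      have hu (u : Eˣ) : u ^ q ^ n = u :=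
        Units.ext (by simpa [hE] using FiniteField.pow_card (u : E))
      rw [Function.isPeriodicPt_pow_iff, hψ, ← map_pow, hu]
    have hfix := Function.isPeriodicPt_pow_iff.mp (hper.mul_const k)
    rw [hk, pow_succ, pow_mul, hfix]
end

section
/- Let p and l be distinct primes, q a power of p, and n a positive integer coprime to l. Let E ⊆ L be an extension of finite fields with |E| = q^n and [L : E] = l. Let ψ : Eˣ → ℂˣ be a group homomorphism and define φ : Lˣ → ℂˣ by φ(x) = ψ(N_{L/E}(x)). Then φ is regular if and only if ψ is regular; here φ is called regular if for every k with 1 ≤ k ≤ n−1 there exists x ∈ Lˣ with φ(x^(q^(l·k))) ≠ φ(x), and ψ is called regular if for every k with 1 ≤ k ≤ n−1 there exists y ∈ Eˣ with ψ(y^(q^k)) ≠ ψ(y). -/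
theorem MonoidHom.map_pow_pow_mul_eq {G H : Type*} [Monoid G] [Monoid H] (ψ : G →* H) {q k : ℕ}
    (h : ∀ y, ψ (y ^ q ^ k) = ψ y) (j : ℕ) (y : G) : ψ (y ^ q ^ (j * k)) = ψ y := by
  induction j with
  | zero => simp
  | succ j ih => rw [Nat.succ_mul, pow_add, pow_mul, h, ih]

theorem FiniteField.units_pow_pow_mod {E : Type*} [Field E] [Fintype E] {q n : ℕ}
    (hE : Fintype.card E = q ^ n) (m : ℕ) (y : Eˣ) : y ^ q ^ (m % n) = y ^ q ^ m := by
  have hy : y ^ q ^ (n * (m / n)) = y := by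
    ext
    rw [Units.val_pow_eq_pow_val, pow_mul, ← hE, FiniteField.pow_card_pow]
  conv_rhs => rw [← Nat.div_add_mod m n, pow_add, pow_mul, hy]


/-- Let `p` and `l` be distinct primes, `q` a power of `p`, and `n` a
positive integer coprime to `l`.  Let `E ⊆ L` be an extension of finite fields with
`|E| = q ^ n` and `[L : E] = l`.  Let `ψ : Eˣ → ℂˣ` be a group homomorphism and define
`φ : Lˣ → ℂˣ` by `φ x = ψ (N_{L/E} x)`.  Then `φ` is regular iff `ψ` is regular, where
`φ` is regular if for every `1 ≤ k ≤ n - 1` there is `x` with `φ (x ^ (q ^ (l * k))) ≠ φ x`,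
and `ψ` is regular if for every `1 ≤ k ≤ n - 1` there is `y` with `ψ (y ^ (q ^ k)) ≠ ψ y`. -/
theorem norm_pullback_regular_iff_regular
    (p l : ℕ) (hp : p.Prime) (hl : l.Prime) (hpl : p ≠ l)
    (q n : ℕ) (hq : ∃ a : ℕ, 0 < a ∧ q = p ^ a) (hn : 0 < n) (hln : Nat.Coprime l n)
    (E L : Type) [Field E] [Field L] [Algebra E L] [Fintype E] [Fintype L]
    (hE : Fintype.card E = q ^ n) (hdeg : Module.finrank E L = l)
    (ψ : Eˣ →* ℂˣ) (φ : Lˣ →* ℂˣ)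
    (hφ : ∀ x : Lˣ, φ x = ψ (Units.map (Algebra.norm E : L →* E) x)) :
    (∀ k : ℕ, 1 ≤ k → k ≤ n - 1 → ∃ x : Lˣ, φ (x ^ q ^ (l * k)) ≠ φ x) ↔
      (∀ k : ℕ, 1 ≤ k → k ≤ n - 1 → ∃ y : Eˣ, ψ (y ^ q ^ k) ≠ ψ y) := by
  have hpull (x : Lˣ) (m : ℕ) :
      φ (x ^ m) = ψ (Units.map (Algebra.norm E : L →* E) x ^ m) := by
    rw [hφ, map_pow]
  constructor
  · intro h k hk hkn
    by_contra! hψ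
    obtain ⟨x, hx⟩ := h k hk hkn
    exact hx (by rw [hpull, hφ, ψ.map_pow_pow_mul_eq hψ])
  · intro h k hk hkn
    have hlk : 0 < l * k % n := by
      refine Nat.pos_of_ne_zero fun h0 ↦ ?_
      have := Nat.le_of_dvd hk (hln.symm.dvd_of_dvd_mul_left (Nat.dvd_of_mod_eq_zero h0))
      omega
    obtain ⟨y, hy⟩ := h (l * k % n) hlk (Nat.le_sub_one_of_lt (Nat.mod_lt _ hn))
    obtain ⟨x, rfl⟩ := FiniteField.unitsMap_norm_surjective E L y
    refine ⟨x, ?_⟩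
    rwa [hpull, hφ, ← FiniteField.units_pow_pow_mod hE]
end

section
/- Let q ≥ 2 be an integer, l a prime, and n a positive integer with gcd(l, n) = 1. Let m be a positive integer dividing q^(l·n) − 1. Then there exists an integer i ≥ 1 with m dividing q^(l·i − 1) − 1 if and only if m divides q^n − 1. -/
/-- Let `q ≥ 2` be an integer, `l` a prime, and `n` a positive integer
with `gcd(l, n) = 1`.  Let `m` be a positive integer dividing `q ^ (l * n) - 1`.  Then
there exists an integer `i ≥ 1` with `m ∣ q ^ (l * i - 1) - 1` if and only if
`m ∣ q ^ n - 1`. -/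
theorem frobenius_fixed_divisibility_criterion
    (q l n m : ℕ) (hq : 2 ≤ q) (hl : l.Prime) (hn : 0 < n)
    (hln : Nat.gcd l n = 1) (hm : 0 < m) (hdvd : m ∣ q ^ (l * n) - 1) :
    (∃ i : ℕ, 1 ≤ i ∧ m ∣ q ^ (l * i - 1) - 1) ↔ m ∣ q ^ n - 1 := by
  constructor
  · rintro ⟨i, hi, h⟩
    have hpos : 1 ≤ l * i := Nat.mul_pos hl.pos hi
    have hcop : Nat.Coprime (l * i - 1) l :=
      Nat.Coprime.coprime_mul_right_right
        ((Nat.coprime_self_sub_left hpos).mpr (Nat.coprime_one_left (l * i)))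
    have hgcd : Nat.gcd (l * n) (l * i - 1) ∣ n :=
      (hcop.coprime_dvd_left (Nat.gcd_dvd_right _ _)).dvd_of_dvd_mul_left
        (Nat.gcd_dvd_left _ _)
    have hm' := Nat.dvd_gcd hdvd h
    rw [Nat.pow_sub_one_gcd_pow_sub_one] at hm'
    exact hm'.trans (Nat.pow_sub_one_dvd_pow_sub_one q hgcd)
  · intro h
    have htot : Nat.totient n - 1 + 1 = Nat.totient n :=
      Nat.sub_add_cancel (Nat.totient_pos.mpr hn)
    have hpow : n ∣ l * l ^ (Nat.totient n - 1) - 1 := by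
      rw [← pow_succ', htot]
      exact (Nat.modEq_iff_dvd' (Nat.one_le_pow _ _ hl.pos)).mp
        (Nat.ModEq.pow_totient hln).symm
    exact ⟨l ^ (Nat.totient n - 1), Nat.one_le_pow _ _ hl.pos,
      h.trans (Nat.pow_sub_one_dvd_pow_sub_one q hpow)⟩
end

section
/- Let q ≥ 2 be an integer, l a prime, and n a positive integer with gcd(l, n) = 1. Let m be a positive integer dividing q^n − 1. Then there exists an integer k with 1 ≤ k ≤ n−1 and m dividing q^(l·k) − 1 if and only if there exists an integer k with 1 ≤ k ≤ n−1 and m dividing q^k − 1. -/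
/-- Let `q ≥ 2` be an integer, `l` a prime, and `n` a positive integer
with `gcd(l, n) = 1`.  Let `m` be a positive integer dividing `q ^ n - 1`.  Then there
exists `k` with `1 ≤ k ≤ n - 1` and `m ∣ q ^ (l * k) - 1` if and only if there exists
`k` with `1 ≤ k ≤ n - 1` and `m ∣ q ^ k - 1`. -/
theorem regularity_divisibility_criterion
    (q l n m : ℕ) (hq : 2 ≤ q) (hl : l.Prime) (hn : 0 < n)
    (hln : Nat.gcd l n = 1) (hm : 0 < m) (hdvd : m ∣ q ^ n - 1) :
    (∃ k : ℕ, 1 ≤ k ∧ k ≤ n - 1 ∧ m ∣ q ^ (l * k) - 1) ↔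
      (∃ k : ℕ, 1 ≤ k ∧ k ≤ n - 1 ∧ m ∣ q ^ k - 1) := by
  have hgcd (k : ℕ) : Nat.gcd (l * k) n = Nat.gcd k n :=
    Nat.Coprime.gcd_mul_left_cancel k hln
  constructor
  · rintro ⟨k, hk, hkn, h⟩
    have h' := Nat.dvd_gcd h hdvd
    rw [Nat.pow_sub_one_gcd_pow_sub_one, hgcd] at h'
    exact ⟨k, hk, hkn, h'.trans (Nat.pow_sub_one_dvd_pow_sub_one q (Nat.gcd_dvd_left k n))⟩
  · rintro ⟨k, hk, hkn, h⟩
    exact ⟨k, hk, hkn, h.trans (Nat.pow_sub_one_dvd_pow_sub_one q (Nat.dvd_mul_left k l))⟩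
end

section
/- Let l be a prime, let R be a commutative ring with no l-torsion (i.e. l·x = 0 implies x = 0 for x ∈ R), let G be a finite group, let σ be an automorphism of G with σ^l = id, and let U be a subgroup of G with σ(U) = U and gcd(|U|, l) = 1. Let ψ : U → Rˣ be a group homomorphism with ψ(σ(u)) = ψ(u) for all u ∈ U. Consider the R-module W = { f : G → R | f(u·g) = ψ(u)·f(g) for all u ∈ U, g ∈ G } and the map Λ : W → W defined by (Λ f)(g) = f(σ(g)). Then Λ is a well-defined R-linear automorphism of W with Λ^l = id, and ker(id + Λ + Λ² + ⋯ + Λ^(l−1)) = im(id − Λ); that is, the Tate cohomology group T¹(W, Λ) vanishes. -/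
/-- The `R`-module of functions `f : G → R` satisfying `f (u * g) = ψ u * f g` for all
`u ∈ U` and `g ∈ G`; this is the model of the representation of `G` induced from the
character `ψ` of the subgroup `U`. -/
def inducedCharModule (R : Type) [CommRing R] {G : Type} [Group G] (U : Subgroup G)
    (ψ : U →* Rˣ) : Submodule R (G → R) where
  carrier := {f | ∀ (u : U) (g : G), f (↑u * g) = (ψ u : R) * f g}
  add_mem' := by
    intro a b ha hb u g
    simp only [Pi.add_apply, ha u g, hb u g, mul_add]
  zero_mem' := by
    intro u g
    simp
  smul_mem' := by
    intro c f hf u g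
    simp only [Pi.smul_apply, smul_eq_mul, hf u g]
    ring

open Finset Function in
/-- A permutation whose `l`-th power is trivial, `l` prime, admits a function whose sum over every
free orbit is `1`. -/
theorem Equiv.Perm.exists_sum_iterate_eq_one {X : Type*} (R : Type*) [Semiring R] {l : ℕ}
    (hl : l.Prime) (τ : Equiv.Perm X) (hτ : τ ^ l = 1) :
    ∃ e : X → R, ∀ x, τ x ≠ x → ∑ i ∈ range l, e (τ^[i] x) = 1 := by
  classical
  let c : X → X := fun x => (Quotient.mk (SameCycle.setoid τ) x).out
  have hc : ∀ x, τ.SameCycle (c x) x := fun x =>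
    Quotient.exact (s := SameCycle.setoid τ) (Quotient.out_eq _)
  have hci : ∀ x (i : ℕ), c (τ^[i] x) = c x := fun x i => by
    refine congrArg Quotient.out (Quotient.sound (s := SameCycle.setoid τ) ?_)
    refine SameCycle.symm ⟨i, ?_⟩
    rw [zpow_natCast, Equiv.Perm.iterate_eq_pow]
  refine ⟨fun x => if x = c x then 1 else 0, fun x hx => ?_⟩
  have hper : minimalPeriod τ x = l := by
    have : Fact l.Prime := ⟨hl⟩
    refine minimalPeriod_eq_prime ?_ hx
    rw [IsPeriodicPt, Equiv.Perm.iterate_eq_pow, hτ]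
    exact rfl
  obtain ⟨k, hk, hkx⟩ : ∃ k < l, τ^[k] x = c x := by
    obtain ⟨n, hn⟩ := (hc x).symm
    have hl0 : (l : ℤ) ≠ 0 := by exact_mod_cast hl.ne_zero
    have hn0 := Int.emod_nonneg n hl0
    have hnl := Int.emod_lt_of_pos n (by exact_mod_cast hl.pos : (0 : ℤ) < l)
    refine ⟨(n % l).toNat, by omega, ?_⟩
    rw [Equiv.Perm.iterate_eq_pow, ← zpow_natCast, Int.toNat_of_nonneg hn0, ← hn]
    conv_rhs => rw [← Int.emod_add_mul_ediv n l, zpow_add, zpow_mul, zpow_natCast, hτ, one_zpow,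
      mul_one]
  rw [sum_eq_single_of_mem k (mem_range.2 hk)]
  · exact if_pos ((hci x k).symm ▸ hkx)
  · intro i hi hik
    refine if_neg fun h => ?_
    rw [hci, ← hkx] at h
    refine hik (iterate_injOn_Iio_minimalPeriod (f := τ) (x := x) ?_ ?_ h)
    · simpa [hper] using hi
    · simpa [hper] using hk

/-- A contracting homotopy for the norm: if the sum of `f` over every `s`-orbit vanishes, then
`f * ∑ i, e ∘ s^[i]` is of the form `h - h ∘ s`. -/
theorem mul_sum_iterate_eq_sub {X R : Type*} [CommRing R] {l : ℕ} {s : X → X}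
    (hs : ∀ x, s^[l] x = x) (e f : X → R) {x : X}
    (hf : ∑ i ∈ Finset.range l, f (s^[i] x) = 0) :
    (f x * ∑ i ∈ Finset.range l, e (s^[i] x)) =
      (∑ i ∈ Finset.range l, e (s^[i] x) * ∑ j ∈ Finset.range i, f (s^[j] x)) -
        ∑ i ∈ Finset.range l, e (s^[i] (s x)) * ∑ j ∈ Finset.range i, f (s^[j] (s x)) := by
  have h₁ : ∀ i, e (s^[i] (s x)) * ∑ j ∈ Finset.range i, f (s^[j] (s x)) =
      e (s^[i + 1] x) * ∑ j ∈ Finset.range (i + 1), f (s^[j] x) - f x * e (s^[i + 1] x) := by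
    intro i
    rw [Finset.sum_range_succ' (fun j => f (s^[j] x)) i]
    simp only [Function.iterate_succ_apply, Function.iterate_zero, id]
    ring
  have h₂ := Finset.sum_range_succ' (fun i => e (s^[i] x) * ∑ j ∈ Finset.range i, f (s^[j] x)) l
  rw [Finset.sum_range_succ, hf] at h₂
  have h₃ := Finset.sum_range_succ' (fun i => e (s^[i] x)) l
  rw [Finset.sum_range_succ, hs] at h₃
  simp only [Finset.sum_congr rfl fun i _ => h₁ i, Finset.sum_sub_distrib, ← Finset.mul_sum]
  simp only [Finset.range_zero, Finset.sum_empty, mul_zero, add_zero, Function.iterate_zero,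
    id] at h₂ h₃
  rw [← h₂, add_right_cancel h₃]
  ring

/-- Let `l` be a prime, `R` a commutative ring with no `l`-torsion,
`G` a finite group, `σ` an automorphism of `G` with `σ ^ l = 1`, and `U` a subgroup of
`G` with `σ(U) = U` and `gcd(|U|, l) = 1`.  Let `ψ : U → Rˣ` be a character with
`ψ (σ u) = ψ u`.  Let `W` be the induced module
`{ f : G → R | f (u * g) = ψ u * f g }`, and `Λ` the operator `(Λ f) g = f (σ g)`.
Then `Λ` is a well-defined `R`-linear automorphism of `W` with `Λ ^ l = 1`, and on `W`
one has `ker (1 + Λ + ⋯ + Λ^(l-1)) = im (1 - Λ)`: the Tate cohomology group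
`T¹(W, Λ)` vanishes. -/
theorem tate_one_of_induced_character_module_vanishes
    (l : ℕ) (hl : l.Prime) (R : Type) [CommRing R]
    (hR : ∀ x : R, l • x = 0 → x = 0)
    (G : Type) [Group G] [Finite G] (σ : MulAut G) (hσ : σ ^ l = 1)
    (U : Subgroup G) (hU : Subgroup.map σ.toMonoidHom U = U)
    (hcop : Nat.Coprime (Nat.card U) l)
    (ψ : U →* Rˣ)
    (hψ : ∀ (u : U) (hu : σ ↑u ∈ U), ψ ⟨σ ↑u, hu⟩ = ψ u)
    (Λ : (G → R) →ₗ[R] (G → R)) (hΛ : Λ = LinearMap.funLeft R R ⇑σ) :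
    (∀ f ∈ inducedCharModule R U ψ, Λ f ∈ inducedCharModule R U ψ) ∧
      Λ ^ l = 1 ∧
      (∀ f ∈ inducedCharModule R U ψ,
        ((∑ i ∈ Finset.range l, Λ ^ i) f = 0 ↔
          ∃ g ∈ inducedCharModule R U ψ, f = g - Λ g)) := by
  have hσU : ∀ g, σ g ∈ U ↔ g ∈ U := fun g => by
    constructor
    · intro h
      rw [← hU] at h
      obtain ⟨v, hv, hvg⟩ := h
      exact σ.injective hvg ▸ hv
    · intro h
      rw [← hU]
      exact ⟨g, h, rfl⟩
  have hσl : ∀ g, σ^[l] g = g := fun g => by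
    rw [show (⇑σ)^[l] = ⇑(σ ^ l) from (hom_coe_pow _ rfl (fun _ _ => rfl) _ _).symm, hσ]
    rfl
  have hΛi : ∀ (i : ℕ) (f : G → R) (g : G), (Λ ^ i) f g = f (σ^[i] g) := by
    intro i
    induction i with
    | zero => intro f g; rfl
    | succ i ih =>
      intro f g
      rw [pow_succ, Module.End.mul_apply, ih, hΛ, LinearMap.funLeft_apply,
        Function.iterate_succ_apply']
  have hN : ∀ (f : G → R) (g : G),
      (∑ i ∈ Finset.range l, Λ ^ i) f g = ∑ i ∈ Finset.range l, f (σ^[i] g) := by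
    intro f g
    simp only [LinearMap.sum_apply, Finset.sum_apply, hΛi]
  have hW : ∀ f ∈ inducedCharModule R U ψ, Λ f ∈ inducedCharModule R U ψ := by
    intro f hf u g
    have hu := (hσU u).2 u.2
    have h := hf ⟨σ u, hu⟩ (σ g)
    rw [hψ u hu] at h
    simpa only [hΛ, LinearMap.funLeft_apply, map_mul] using h
  have hWi : ∀ (i : ℕ), ∀ f ∈ inducedCharModule R U ψ, ∀ (u : U) (g : G),
      f (σ^[i] (u * g)) = ψ u * f (σ^[i] g) := by
    intro i f hf u g
    have h : (Λ ^ i) f ∈ inducedCharModule R U ψ := by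
      induction i with
      | zero => exact hf
      | succ i ih => rw [pow_succ']; exact hW _ ih
    simpa only [hΛi] using h u g
  have hΛl : Λ ^ l = 1 := by
    refine LinearMap.ext fun f => funext fun g => ?_
    rw [hΛi, hσl]
    rfl
  refine ⟨hW, hΛl, fun f hf => ⟨fun hNf => ?_, ?_⟩⟩
  · have hsum : ∀ g, ∑ i ∈ Finset.range l, f (σ^[i] g) = 0 := fun g => by
      rw [← hN, hNf]
      rfl
    have hfix : ∀ g, σ g * g⁻¹ ∈ U → f g = 0 := by
      intro g hg
      obtain ⟨u, hu⟩ : ∃ u : U, σ g = u * g := ⟨⟨_, hg⟩, by simp⟩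
      have hiter : ∀ i : ℕ, ∃ v : U, σ^[i] g = v * g ∧ ψ v = ψ u ^ i := by
        intro i
        induction i with
        | zero => exact ⟨1, by simp, by simp⟩
        | succ i ih =>
          obtain ⟨v, hv, hvi⟩ := ih
          have hσv := (hσU v).2 v.2
          refine ⟨⟨σ v, hσv⟩ * u, ?_, ?_⟩
          · rw [Function.iterate_succ_apply', hv, map_mul, hu, Subgroup.coe_mul, mul_assoc]
          · rw [map_mul, hψ, hvi, pow_succ]
      have hψl : ψ u ^ l = 1 := by
        obtain ⟨v, hv, hvl⟩ := hiter l
        rw [hσl, right_eq_mul] at hv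
        rw [← hvl, Subtype.ext (a1 := v) (a2 := 1) hv, map_one]
      have hψU : ψ u ^ Nat.card U = 1 := by
        rw [← map_pow, pow_card_eq_one', map_one]
      have hψ1 : ψ u = 1 := by
        rw [← orderOf_eq_one_iff, ← Nat.dvd_one, ← hcop.gcd_eq_one]
        exact Nat.dvd_gcd (orderOf_dvd_of_pow_eq_one hψU) (orderOf_dvd_of_pow_eq_one hψl)
      refine hR _ ?_
      rw [← hsum g, ← Finset.card_range l, ← Finset.sum_const, Finset.card_range]
      refine Finset.sum_congr rfl fun i _ => ?_
      obtain ⟨v, hv, hvi⟩ := hiter i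
      rw [hv, hf, hvi, hψ1, one_pow, Units.val_one, one_mul]
    let τ : Equiv.Perm (Quotient (QuotientGroup.rightRel U)) :=
      Quotient.congr σ.toEquiv fun a b => by
        rw [QuotientGroup.rightRel_apply, QuotientGroup.rightRel_apply, ← hσU]
        simp
    have hτi : ∀ (i : ℕ) (g : G), τ^[i] (Quotient.mk _ g) = Quotient.mk _ (σ^[i] g) := by
      intro i g
      induction i with
      | zero => rfl
      | succ i ih =>
        rw [Function.iterate_succ_apply', ih, Function.iterate_succ_apply']
        rfl
    obtain ⟨e, he⟩ := τ.exists_sum_iterate_eq_one R hl <| by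
      refine Equiv.ext fun x => ?_
      induction x using Quotient.inductionOn with
      | h g => rw [← Equiv.Perm.iterate_eq_pow, hτi, hσl, Equiv.Perm.one_apply]
    have heU : ∀ (i : ℕ) (u : U) (g : G), e (Quotient.mk _ (σ^[i] (u * g))) =
        e (Quotient.mk _ (σ^[i] g)) := by
      intro i u g
      rw [← hτi, ← hτi]
      refine congrArg (fun x => e (τ^[i] x)) (Quotient.sound ?_)
      refine QuotientGroup.rightRel_apply.2 ?_
      simp
    refine ⟨fun g => ∑ i ∈ Finset.range l, e (Quotient.mk _ (σ^[i] g)) *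
      ∑ j ∈ Finset.range i, f (σ^[j] g), fun u g => ?_, funext fun g => ?_⟩
    · simp only [heU, hWi _ f hf, ← Finset.mul_sum, mul_left_comm _ (ψ u : R)]
    · rw [Pi.sub_apply, hΛ, LinearMap.funLeft_apply,
        ← mul_sum_iterate_eq_sub hσl (fun g => e (Quotient.mk _ g)) f (hsum g)]
      by_cases hg : σ g * g⁻¹ ∈ U
      · rw [hfix g hg, zero_mul]
      · have h := he (Quotient.mk _ g) fun h => hg <|
          QuotientGroup.rightRel_apply.1 (Quotient.exact h.symm)
        simp only [hτi] at h
        rw [h, mul_one]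
  · rintro ⟨g, -, rfl⟩
    have h := LinearMap.congr_fun (geom_sum_mul_neg Λ l) g
    rw [hΛl, sub_self] at h
    exact h
end

section
/- Let l be a prime, let R be a commutative ring, let X be a type, and let e : X ≃ X be a bijection with e^l = id. Let M = X →₀ R be the free R-module on X, let σ : M → M be the R-linear automorphism induced by e (mapping the basis vector at x to the basis vector at e(x)), and write N = id + σ + σ² + ⋯ + σ^(l−1). Then the map sending an element f ∈ ker(id − σ) to the finitely supported function on the fixed-point set X^e = {x ∈ X | e(x) = x} given by x ↦ (f(x) mod l·R) induces an R-linear isomorphism from the Tate cohomology group T⁰(M, σ) = ker(id − σ)/im(N) onto the free (R/lR)-module (X^e →₀ R/lR) on X^e. -/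
theorem Finsupp.lmapDomain_perm_pow_apply {R X : Type*} [CommRing R] (e : Equiv.Perm X)
    (i : ℕ) (g : X →₀ R) (x : X) :
    ((Finsupp.lmapDomain R R (⇑e)) ^ i) g x = g (e.symm^[i] x) := by
  induction i generalizing x with
  | zero => simp
  | succ i ih =>
    rw [pow_succ', Module.End.mul_apply, Finsupp.lmapDomain_apply,
      Finsupp.mapDomain_equiv_apply, ih, Function.iterate_succ_apply]

theorem Finsupp.sum_lmapDomain_perm_pow_apply {R X : Type*} [CommRing R] (e : Equiv.Perm X)
    (n : ℕ) (g : X →₀ R) (x : X) :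
    (∑ i ∈ Finset.range n, (Finsupp.lmapDomain R R (⇑e)) ^ i) g x =
      ∑ i ∈ Finset.range n, g (e.symm^[i] x) := by
  rw [LinearMap.sum_apply, Finsupp.finsetSum_apply]
  exact Finset.sum_congr rfl fun i _ => lmapDomain_perm_pow_apply e i g x

/-- A choice of a representative in each cycle of `d`; on a cycle of prime length `l`, the
representative is reached from any point after a unique number `i < l` of steps. -/
theorem Equiv.Perm.exists_cycle_representative {X : Type*} {l : ℕ} (hl : l.Prime)
    (d : Equiv.Perm X) (hd : d ^ l = 1) :
    ∃ rep : X → X, (∀ x, rep (d x) = rep x) ∧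
      ∀ x, d x ≠ x → ∃ i < l, ∀ j < l, d^[j] x = rep x ↔ j = i := by
  let s := Equiv.Perm.SameCycle.setoid d
  refine ⟨fun x => (Quotient.mk s x).out, fun x => ?_, fun x hx => ?_⟩
  · have : Quotient.mk s (d x) = Quotient.mk s x :=
      Quotient.sound (Equiv.Perm.sameCycle_apply_left.2 (Equiv.Perm.SameCycle.refl d x))
    exact congrArg Quotient.out this
  · obtain ⟨k, hk⟩ : d.SameCycle x (Quotient.mk s x).out :=
      Equiv.Perm.SameCycle.symm (Quotient.mk_out x)
    have hl0 : (l : ℤ) ≠ 0 := by exact_mod_cast hl.ne_zero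
    obtain ⟨i, hi⟩ := Int.eq_ofNat_of_zero_le (Int.emod_nonneg k hl0)
    have hil : i < l := by
      have := Int.emod_lt_of_pos k (b := l) (by exact_mod_cast hl.pos)
      omega
    rw [zpow_eq_zpow_emod' k hd, hi, zpow_natCast, ← Equiv.Perm.iterate_eq_pow] at hk
    have := Fact.mk hl
    have hper : Function.minimalPeriod d x = l := by
      refine Function.minimalPeriod_eq_prime ?_ hx
      change d^[l] x = x
      rw [Equiv.Perm.iterate_eq_pow, hd, Equiv.Perm.one_apply]
    refine ⟨i, hil, fun j hj => ⟨fun h => ?_, fun h => h ▸ hk⟩⟩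
    exact Function.iterate_injOn_Iio_minimalPeriod (f := d) (x := x)
      (by simpa [hper] using hj) (by simpa [hper] using hil) (h.trans hk.symm)

/-- A finitely supported function invariant under a permutation of prime order `l`, with values
divisible by `l` at fixed points, is a norm. -/
theorem Finsupp.mem_range_sum_lmapDomain_perm_pow {R X : Type*} [CommRing R] {l : ℕ}
    (hl : l.Prime) (e : Equiv.Perm X) (he : e ^ l = 1) (f : X →₀ R)
    (hf : ∀ x, f (e.symm x) = f x) (hfix : ∀ x, e x = x → (l : R) ∣ f x) :
    f ∈ LinearMap.range (∑ i ∈ Finset.range l, (Finsupp.lmapDomain R R (⇑e)) ^ i) := by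
  classical
  have hd : e.symm ^ l = 1 := by
    change e⁻¹ ^ l = 1
    rw [inv_pow, he, inv_one]
  obtain ⟨rep, hrep, hrep'⟩ := Equiv.Perm.exists_cycle_representative hl e.symm hd
  have hc : ∀ r : R, ∃ c, (r = 0 → c = 0) ∧ ((l : R) ∣ r → l * c = r) := by
    intro r
    by_cases h0 : r = 0
    · exact ⟨0, by simp [h0]⟩
    · by_cases h : (l : R) ∣ r
      · obtain ⟨c, hc⟩ := h
        exact ⟨c, fun h => absurd h h0, fun _ => hc.symm⟩
      · exact ⟨0, fun _ => rfl, fun h' => absurd h' h⟩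
  choose c hc0 hc using hc
  refine ⟨Finsupp.onFinset f.support
    (fun x => if e.symm x = x then c (f x) else if x = rep x then f x else 0) ?_, ?_⟩
  · intro x hx
    rw [Finsupp.mem_support_iff]
    intro h
    simp [h, hc0] at hx
  · ext x
    rw [sum_lmapDomain_perm_pow_apply]
    simp only [Finsupp.onFinset_apply]
    by_cases hx : e.symm x = x
    · have hit : ∀ i, e.symm^[i] x = x := fun i => Function.iterate_fixed hx i
      simp only [hit, hx, if_true, Finset.sum_const, Finset.card_range, nsmul_eq_mul]
      exact hc _ (hfix x (e.symm_apply_eq.1 hx).symm)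
    · obtain ⟨i, hil, hi⟩ := hrep' x hx
      have hfit : ∀ j, f (e.symm^[j] x) = f x := by
        intro j
        induction j with
        | zero => rfl
        | succ j ih => rw [Function.iterate_succ_apply', hf, ih]
      have hrit : ∀ j, rep (e.symm^[j] x) = rep x := by
        intro j
        induction j with
        | zero => rfl
        | succ j ih => rw [Function.iterate_succ_apply', hrep, ih]
      have hnf : ∀ j, e.symm (e.symm^[j] x) ≠ e.symm^[j] x := by
        intro j h
        rw [← Function.iterate_succ_apply' e.symm, Function.iterate_succ_apply] at h
        exact hx (e.symm.injective.iterate j h)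
      simp only [hfit, hrit, hnf, if_false]
      rw [Finset.sum_eq_single_of_mem i (Finset.mem_range.2 hil), if_pos ((hi i hil).2 rfl)]
      intro j hj hji
      exact if_neg fun h => hji ((hi j (Finset.mem_range.1 hj)).1 h)

/-- Let `l` be a prime, `R` a commutative ring, `X` a type, and
`e : X ≃ X` a bijection with `e ^ l = 1`.  Let `σ` be the `R`-linear automorphism of the
free module `M = X →₀ R` induced by `e`, and `N = 1 + σ + ⋯ + σ^(l-1)`.  Then the map
sending `f ∈ ker (1 - σ)` to the finitely supported function `x ↦ f x mod l·R` on the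
fixed-point set `X^e = {x | e x = x}` induces an `R`-linear isomorphism from the Tate
cohomology group `T⁰(M, σ) = ker (1 - σ) / im N` onto the free `R/lR`-module
`X^e →₀ R/lR`.  (Equivalently, by the first isomorphism theorem: the map is a
well-defined `R`-linear map, it is surjective, and its kernel is exactly the image of
`N` inside `ker (1 - σ)`.) -/
theorem tate_zero_of_free_module
    (l : ℕ) (hl : l.Prime) (R : Type) [CommRing R] (X : Type)
    (e : Equiv.Perm X) (he : e ^ l = 1)
    (σ : (X →₀ R) →ₗ[R] (X →₀ R)) (hσ : σ = Finsupp.lmapDomain R R (⇑e)) :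
    ∃ Φ : ↥(LinearMap.ker (1 - σ)) →ₗ[R]
        ({x : X // e x = x} →₀ (R ⧸ Ideal.span {(l : R)})),
      (∀ (f : ↥(LinearMap.ker (1 - σ))) (x : {x : X // e x = x}),
          Φ f x = Ideal.Quotient.mk (Ideal.span {(l : R)}) ((f : X →₀ R) x)) ∧
      Function.Surjective Φ ∧
      LinearMap.ker Φ =
        (LinearMap.range (∑ i ∈ Finset.range l, σ ^ i)).comap
          (LinearMap.ker (1 - σ)).subtype := by
  subst hσ
  let Φ : (X →₀ R) →ₗ[R] ({x : X // e x = x} →₀ (R ⧸ Ideal.span {(l : R)})) :=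
    (Finsupp.mapRange.linearMap (Submodule.mkQ (Ideal.span {(l : R)}))).comp
      (Finsupp.lcomapDomain Subtype.val Subtype.val_injective)
  have hΦ : ∀ f x, Φ f x = Ideal.Quotient.mk (Ideal.span {(l : R)}) (f x.1) := fun _ _ => rfl
  have hinv : ∀ f ∈ LinearMap.ker (1 - Finsupp.lmapDomain R R (⇑e)),
      ∀ x, f (e.symm x) = f x := by
    intro f hf x
    have h := DFunLike.congr_fun (sub_eq_zero.1 (LinearMap.mem_ker.1 hf)) x
    rw [Module.End.one_apply, Finsupp.lmapDomain_apply, Finsupp.mapDomain_equiv_apply] at h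
    exact h.symm
  refine ⟨Φ.comp (LinearMap.ker (1 - Finsupp.lmapDomain R R (⇑e))).subtype,
    fun f x => hΦ f x, fun g => ?_, ?_⟩
  · obtain ⟨g, rfl⟩ := Finsupp.mapRange_surjective _ (map_zero _)
      (Submodule.mkQ_surjective (Ideal.span {(l : R)})) g
    refine ⟨⟨Finsupp.mapDomain Subtype.val g, ?_⟩, ?_⟩
    · have h : ⇑e ∘ (Subtype.val : {x : X // e x = x} → X) = Subtype.val :=
        funext fun x => x.2
      rw [LinearMap.mem_ker, LinearMap.sub_apply, Module.End.one_apply,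
        Finsupp.lmapDomain_apply, ← Finsupp.mapDomain_comp, h, sub_self]
    · ext x
      rw [LinearMap.comp_apply, hΦ, Submodule.subtype_apply,
        Finsupp.mapDomain_apply Subtype.val_injective]
      rfl
  · ext f
    rw [LinearMap.ker_comp, Submodule.mem_comap, Submodule.mem_comap, Submodule.subtype_apply]
    constructor
    · intro h
      refine Finsupp.mem_range_sum_lmapDomain_perm_pow hl e he f.1 (hinv f.1 f.2) fun x hx => ?_
      have h' := DFunLike.congr_fun (LinearMap.mem_ker.1 h) ⟨x, hx⟩
      rw [hΦ, Finsupp.zero_apply, Ideal.Quotient.eq_zero_iff_mem] at h'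
      exact Ideal.mem_span_singleton.1 h'
    · rintro ⟨g, hg⟩
      rw [LinearMap.mem_ker, ← hg]
      ext x
      have hit : ∀ i, e.symm^[i] x.1 = x.1 :=
        fun i => Function.iterate_fixed (e.symm_apply_eq.2 x.2.symm) i
      rw [hΦ, Finsupp.zero_apply, Ideal.Quotient.eq_zero_iff_mem,
        Finsupp.sum_lmapDomain_perm_pow_apply, Ideal.mem_span_singleton]
      simp [hit]
end

section
/- Let l be a prime, let R be a commutative ring with no l-torsion (i.e. l·x = 0 implies x = 0 for x ∈ R), let X be a type, and let e : X ≃ X be a bijection with e^l = id. Let M = X →₀ R be the free R-module on X and let σ : M → M be the R-linear automorphism induced by e (mapping the basis vector at x to the basis vector at e(x)). Then ker(id + σ + σ² + ⋯ + σ^(l−1)) = im(id − σ); that is, the Tate cohomology group T¹(M, σ) vanishes. -/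
namespace Finsupp

variable {R X : Type*} [CommRing R]

theorem lmapDomain_perm_pow (e : Equiv.Perm X) (n : ℕ) :
    (lmapDomain R R e : (X →₀ R) →ₗ[R] (X →₀ R)) ^ n = lmapDomain R R ⇑(e ^ n) := by
  induction n with
  | zero => ext; simp
  | succ n ih => rw [pow_succ, ih, pow_succ, Equiv.Perm.coe_mul, lmapDomain_comp]; rfl

theorem lmapDomain_perm_pow_apply_s8 (e : Equiv.Perm X) (n : ℕ) (f : X →₀ R) (y : X) :
    ((lmapDomain R R e : (X →₀ R) →ₗ[R] (X →₀ R)) ^ n) f y = f ((e ^ n)⁻¹ y) := by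
  rw [lmapDomain_perm_pow, lmapDomain_apply]
  exact mapDomain_equiv_apply (f := e ^ n) f y

theorem single_sub_single_mem_range_one_sub_of_sameCycle {e : Equiv.Perm X} {x y : X}
    (h : e.SameCycle x y) (r : R) :
    single x r - single y r ∈
      LinearMap.range (1 - (lmapDomain R R e : (X →₀ R) →ₗ[R] (X →₀ R))) := by
  have step (z : X) : single z r - single (e z) r ∈
      LinearMap.range (1 - (lmapDomain R R e : (X →₀ R) →ₗ[R] (X →₀ R))) :=
    ⟨single z r, by simp [mapDomain_single]⟩
  obtain ⟨i, rfl⟩ := h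
  induction i with
  | zero => simp
  | succ n ih =>
    rw [add_comm, zpow_add, zpow_one, Equiv.Perm.mul_apply]
    simpa using add_mem ih (step ((e ^ (n : ℤ)) x))
  | pred n ih =>
    have hz := step ((e ^ (-(n : ℤ) - 1)) x)
    rw [← Equiv.Perm.mul_apply, ← zpow_one_add, add_sub_cancel] at hz
    simpa using sub_mem ih hz

/-- Modulo the image of `1 - σ`, pushing forward along a map that moves points only within
their cycles changes nothing. -/
theorem sub_mapDomain_mem_range_one_sub {e : Equiv.Perm X} {s : X → X}
    (hs : ∀ x, e.SameCycle x (s x)) (f : X →₀ R) :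
    f - mapDomain s f ∈
      LinearMap.range (1 - (lmapDomain R R e : (X →₀ R) →ₗ[R] (X →₀ R))) := by
  induction f using Finsupp.induction_linear with
  | zero => simp
  | add f g hf hg => rw [mapDomain_add, add_sub_add_comm]; exact add_mem hf hg
  | single x r =>
    rw [mapDomain_single]
    exact single_sub_single_mem_range_one_sub_of_sameCycle (hs x) r

end Finsupp

theorem Equiv.Perm.apply_eq_self_of_pow_apply_eq_self_of_prime {X : Type*} {e : Equiv.Perm X}
    {l : ℕ} (hl : l.Prime) (he : e ^ l = 1) {i : ℕ} (hi₀ : i ≠ 0) (hi : i < l) {y : X}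
    (hy : (e ^ i) y = y) : e y = y := by
  have h₁ : Function.IsPeriodicPt e i y := by
    rwa [Function.IsPeriodicPt, Function.IsFixedPt, Equiv.Perm.iterate_eq_pow]
  have h₂ : Function.IsPeriodicPt e l y := by
    rw [Function.IsPeriodicPt, Function.IsFixedPt, Equiv.Perm.iterate_eq_pow, he]; rfl
  have h := h₂.gcd h₁
  rwa [(Nat.coprime_of_lt_prime hi₀ hi hl).gcd_eq_one] at h

/-- An element of the kernel of the norm whose support meets each cycle in at most one point
is zero. -/
theorem Finsupp.eq_zero_of_geom_sum_lmapDomain_eq_zero {R X : Type*} [CommRing R]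
    {l : ℕ} (hl : l.Prime) (hR : ∀ x : R, l • x = 0 → x = 0)
    {e : Equiv.Perm X} (he : e ^ l = 1) {g : X →₀ R}
    (hsupp : ∀ x ∈ g.support, ∀ y ∈ g.support, e.SameCycle x y → x = y)
    (hg : (∑ i ∈ Finset.range l,
      (lmapDomain R R e : (X →₀ R) →ₗ[R] (X →₀ R)) ^ i) g = 0) : g = 0 := by
  ext y
  by_contra hy
  have hsum : ∑ i ∈ Finset.range l, g ((e ^ i)⁻¹ y) = 0 := by
    have := DFunLike.congr_fun hg y
    simpa only [LinearMap.sum_apply, finsetSum_apply, lmapDomain_perm_pow_apply_s8,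
      zero_apply] using this
  by_cases hfix : e y = y
  · refine hy (hR _ ?_)
    have (i : ℕ) : (e ^ i)⁻¹ y = y := by
      rw [Equiv.Perm.inv_eq_iff_eq, Equiv.Perm.pow_apply_eq_self_of_apply_eq_self hfix]
    simpa [this] using hsum
  · refine hy ?_
    rwa [Finset.sum_eq_single 0 ?_ (by simp [hl.ne_zero]), pow_zero, inv_one] at hsum
    intro i hi hi₀
    by_contra hne
    refine hfix (Equiv.Perm.apply_eq_self_of_pow_apply_eq_self_of_prime hl he hi₀
      (Finset.mem_range.mp hi) (Equiv.Perm.inv_eq_iff_eq.mp ?_).symm)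
    exact hsupp _ (mem_support_iff.mpr hne) _ (mem_support_iff.mpr hy) ⟨i, by simp⟩

/-- Let `l` be a prime, `R` a commutative ring with no `l`-torsion,
`X` a type, and `e : X ≃ X` a bijection with `e ^ l = 1`.  Let `σ` be the `R`-linear
automorphism of the free module `X →₀ R` induced by `e`.  Then
`ker (1 + σ + ⋯ + σ^(l-1)) = im (1 - σ)`, i.e. the Tate cohomology group `T¹` of
`(X →₀ R, σ)` vanishes. -/
theorem tate_one_of_free_module_vanishes
    (l : ℕ) (hl : l.Prime) (R : Type) [CommRing R]
    (hR : ∀ x : R, l • x = 0 → x = 0)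
    (X : Type) (e : Equiv.Perm X) (he : e ^ l = 1) :
    LinearMap.ker
        (∑ i ∈ Finset.range l,
          (Finsupp.lmapDomain R R (⇑e) : (X →₀ R) →ₗ[R] (X →₀ R)) ^ i) =
      LinearMap.range (1 - (Finsupp.lmapDomain R R (⇑e) : (X →₀ R) →ₗ[R] (X →₀ R))) := by
  set σ : (X →₀ R) →ₗ[R] (X →₀ R) := Finsupp.lmapDomain R R e with hσ
  have hle : LinearMap.range (1 - σ) ≤ LinearMap.ker (∑ i ∈ Finset.range l, σ ^ i) := by
    rw [LinearMap.range_le_ker_iff]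
    refine (geom_sum_mul_neg (R := Module.End R (X →₀ R)) σ l).trans ?_
    rw [hσ, Finsupp.lmapDomain_perm_pow, he, Equiv.Perm.coe_one, Finsupp.lmapDomain_id]
    exact sub_self _
  refine le_antisymm (fun f hf ↦ ?_) hle
  let s (x : X) : X := (Quotient.mk (Equiv.Perm.SameCycle.setoid e) x).out
  have hs (x : X) : e.SameCycle x (s x) :=
    (Quotient.mk_out (s := Equiv.Perm.SameCycle.setoid e) x).symm
  have hs_eq {x y : X} (h : e.SameCycle x y) : s x = s y :=
    congrArg Quotient.out (Quotient.sound (s := Equiv.Perm.SameCycle.setoid e) h)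
  have hmem := Finsupp.sub_mapDomain_mem_range_one_sub hs f
  have hzero : Finsupp.mapDomain s f = 0 := by
    refine Finsupp.eq_zero_of_geom_sum_lmapDomain_eq_zero hl hR he ?_ ?_
    · classical
      intro x hx y hy hxy
      obtain ⟨a, -, rfl⟩ := Finset.mem_image.mp (Finsupp.mapDomain_support hx)
      obtain ⟨b, -, rfl⟩ := Finset.mem_image.mp (Finsupp.mapDomain_support hy)
      exact hs_eq ((hs a).trans (hxy.trans (hs b).symm))
    · simpa using sub_mem hf (hle hmem)
  rwa [hzero, sub_zero] at hmem
end

section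
/- Let l be a prime, let G be a group, let σ be an automorphism of G with σ^l = id, and let H be a finite subgroup of G with σ(H) = H and gcd(|H|, l) = 1. If g ∈ G is such that the right coset H·g is σ-stable (i.e. σ(h·g) ∈ H·g for all h ∈ H, equivalently σ(g)·g⁻¹ ∈ H), then there exists h ∈ H with σ(h·g) = h·g; that is, every σ-fixed right coset of H contains a σ-fixed element. -/
/-- Let `l` be a prime, `G` a group, `σ` an automorphism of `G` with
`σ ^ l = 1`, and `H` a finite subgroup of `G` with `σ(H) = H` and `gcd(|H|, l) = 1`.
If `g ∈ G` is such that the right coset `H·g` is `σ`-stable (equivalently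
`σ(g) * g⁻¹ ∈ H`), then there exists `h ∈ H` with `σ (h * g) = h * g`: every
`σ`-fixed right coset of `H` contains a `σ`-fixed element. -/
theorem sigma_fixed_coset_has_fixed_representative
    (l : ℕ) (hl : l.Prime) (G : Type) [Group G] (σ : MulAut G) (hσ : σ ^ l = 1)
    (H : Subgroup G) [Finite H]
    (hH : Subgroup.map σ.toMonoidHom H = H)
    (hcop : Nat.Coprime (Nat.card H) l)
    (g : G) (hg : σ g * g⁻¹ ∈ H) :
    ∃ h ∈ H, σ (h * g) = h * g := by
  classical
  have := Fact.mk hl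
  have := Fintype.ofFinite H
  have map_mem (h : H) : σ h * (σ g * g⁻¹) ∈ H :=
    H.mul_mem (hH.le (Subgroup.mem_map_of_mem σ.toMonoidHom h.2)) hg
  let f : Function.End H := fun h => ⟨σ h * (σ g * g⁻¹), map_mem h⟩
  have f_mul (h : H) : (f h : G) * g = σ (h * g) := by simp [f, mul_assoc]
  have f_pow_mul (n : ℕ) (h : H) : ((f ^ n) h : G) * g = (σ ^ n) (h * g) := by
    induction n with
    | zero => rfl
    | succ n ih =>
      rw [pow_succ', pow_succ', MulAut.mul_apply, ← ih, ← f_mul]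
      rfl
  have f_pow : f ^ l ^ 1 = 1 := by
    funext h
    refine Subtype.ext (mul_right_cancel (b := g) ?_)
    rw [f_pow_mul, pow_one, hσ]
    rfl
  have card_modEq := Equiv.Perm.card_fixedPoints_modEq f_pow
  have not_dvd : ¬ l ∣ Fintype.card H := by
    rw [← Nat.card_eq_fintype_card]
    exact (hl.coprime_iff_not_dvd).mp hcop.symm
  have nonempty : Nonempty (Function.fixedPoints f) := by
    by_contra h
    rw [not_nonempty_iff] at h
    rw [Fintype.card_eq_zero (α := Function.fixedPoints f)] at card_modEq
    exact not_dvd (Nat.modEq_zero_iff_dvd.mp card_modEq)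
  obtain ⟨h, hh⟩ := nonempty
  exact ⟨h, h.2, by rw [← f_mul, show f h = h from hh]⟩
end

section
/- Let R be an integrally closed domain with fraction field K, let V be a K-vector space, and let L be a nonzero finitely generated R-submodule of V. Let l be a positive integer and let φ : V → V be a K-linear automorphism with φ^l = id. If there exists α ∈ K such that the image φ(L) equals α·L = {α·x : x ∈ L}, then α is a unit of R and φ(L) = L. -/
/-- If `f` maps a submodule `L` into `α • L`, then `f ^ n` maps `L` into `α ^ n • L`. -/
theorem Submodule.exists_mem_pow_apply_eq_pow_smul
    {R K V : Type*} [CommRing R] [Field K] [AddCommGroup V] [Module K V] [Module R V]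
    {L : Submodule R V} {f : V ≃ₗ[K] V} {α : K}
    (h : ∀ x ∈ L, ∃ y ∈ L, f x = α • y) (n : ℕ) :
    ∀ x ∈ L, ∃ y ∈ L, (f ^ n) x = α ^ n • y := by
  induction n with
  | zero => exact fun x hx => ⟨x, hx, by simp⟩
  | succ n ih =>
    intro x hx
    obtain ⟨y, hy, hxy⟩ := h x hx
    obtain ⟨z, hz, hyz⟩ := ih y hy
    refine ⟨z, hz, ?_⟩
    rw [pow_succ, LinearEquiv.mul_apply, hxy, map_smul, hyz, smul_smul, pow_succ']

/-- Let `L` be a nonzero finitely generated `R`-submodule of a `K`-vector space. If an automorphism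
of finite order maps `L` into `α • L` with `α ≠ 0`, then `α⁻¹` is integral over `R`. -/
theorem isIntegral_inv_of_apply_mem_smul
    {R K V : Type*} [CommRing R] [Field K] [Algebra R K]
    [AddCommGroup V] [Module K V] [Module R V] [IsScalarTower R K V]
    {L : Submodule R V} (hL0 : L ≠ ⊥) (hLfg : L.FG)
    {l : ℕ} (hl : 0 < l) {f : V ≃ₗ[K] V} (hf : f ^ l = 1) {α : K} (hα : α ≠ 0)
    (h : ∀ x ∈ L, ∃ y ∈ L, f x = α • y) : IsIntegral R α⁻¹ := by
  refine IsIntegral.of_pow hl (isIntegral_of_smul_mem_submodule L hL0 hLfg _ fun x hx => ?_)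
  obtain ⟨y, hy, hxy⟩ := Submodule.exists_mem_pow_apply_eq_pow_smul h l x hx
  rw [hf, LinearEquiv.coe_one, id_eq] at hxy
  rwa [hxy, inv_pow, inv_smul_smul₀ (pow_ne_zero l hα)]

/-- Let `R` be an integrally closed domain with fraction field `K`,
`V` a `K`-vector space, and `L` a nonzero finitely generated `R`-submodule of `V`.
Let `l` be a positive integer and `φ : V → V` a `K`-linear automorphism with `φ ^ l = 1`.
If there is `α ∈ K` with `φ(L) = α • L`, then `α` is a unit of `R` and `φ(L) = L`. -/
theorem lattice_scaled_by_finite_order_automorphism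
    (R : Type) [CommRing R] [IsDomain R] [IsIntegrallyClosed R]
    (K : Type) [Field K] [Algebra R K] [IsFractionRing R K]
    (V : Type) [AddCommGroup V] [Module K V] [Module R V] [IsScalarTower R K V]
    (L : Submodule R V) (hL0 : L ≠ ⊥) (hLfg : L.FG)
    (l : ℕ) (hl : 0 < l) (φ : V ≃ₗ[K] V) (hφ : φ ^ l = 1)
    (α : K)
    (hα : Submodule.map (φ.toLinearMap.restrictScalars R) L =
          Submodule.map ((LinearMap.lsmul K V α).restrictScalars R) L) :
    (∃ u : Rˣ, algebraMap R K u = α) ∧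
      Submodule.map (φ.toLinearMap.restrictScalars R) L = L := by
  have map_mem : ∀ x ∈ L, ∃ y ∈ L, φ x = α • y := by
    intro x hx
    have hmem : φ x ∈ Submodule.map (φ.toLinearMap.restrictScalars R) L := ⟨x, hx, rfl⟩
    rw [hα] at hmem
    obtain ⟨y, hy, hyx⟩ := hmem
    exact ⟨y, hy, hyx.symm⟩
  have smul_mem : ∀ x ∈ L, ∃ y ∈ L, φ y = α • x := by
    intro x hx
    have hmem : α • x ∈ Submodule.map ((LinearMap.lsmul K V α).restrictScalars R) L :=
      ⟨x, hx, rfl⟩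
    rwa [← hα] at hmem
  have hα0 : α ≠ 0 := by
    rintro rfl
    refine hL0 ((Submodule.eq_bot_iff L).2 fun x hx => ?_)
    obtain ⟨y, -, hy⟩ := map_mem x hx
    simpa using hy
  have symm_map_mem : ∀ x ∈ L, ∃ y ∈ L, φ⁻¹ x = α⁻¹ • y := by
    intro x hx
    obtain ⟨y, hy, hyx⟩ := smul_mem x hx
    refine ⟨y, hy, φ.injective ?_⟩
    rw [map_smul, hyx, inv_smul_smul₀ hα0]
    exact φ.apply_symm_apply x
  have inv_integral : IsIntegral R α⁻¹ :=
    isIntegral_inv_of_apply_mem_smul hL0 hLfg hl hφ hα0 map_mem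
  have integral : IsIntegral R α := by
    simpa using isIntegral_inv_of_apply_mem_smul hL0 hLfg hl
      (by rw [inv_pow, hφ, inv_one]) (inv_ne_zero hα0) symm_map_mem
  obtain ⟨a, ha⟩ := IsIntegrallyClosed.isIntegral_iff.1 integral
  obtain ⟨b, hb⟩ := IsIntegrallyClosed.isIntegral_iff.1 inv_integral
  have hab : a * b = 1 := IsFractionRing.injective R K (by
    rw [map_mul, ha, hb, map_one, mul_inv_cancel₀ hα0])
  refine ⟨⟨Units.mkOfMulEqOne a b hab, ha⟩, ?_⟩
  rw [hα]
  ext x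
  constructor
  · rintro ⟨y, hy, rfl⟩
    change α • y ∈ L
    rw [← ha, algebraMap_smul]
    exact L.smul_mem a hy
  · intro hx
    refine ⟨b • x, L.smul_mem b hx, ?_⟩
    change α • b • x = x
    rw [← algebraMap_smul K b x, hb, smul_inv_smul₀ hα0]
end
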